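/- arXiv:1803.05679 — 2 statements merged into one kernel-verified Lean document; each statement's English description precedes it below -/
import Mathlib

section
/- The set T contains no ray that is unbounded: for all a ∈ ℂ and all b ∈ ℂ with b ≠ 0, the ray {a + t·b : t ∈ [0,∞)} is not contained in T. -/
open Real Complex

/-- `h(z) = 5πz + 2πi·sin z`. -/
noncomputable def h (z : ℂ) : ℂ := 5 * (π : ℂ) * z + 2 * (π : ℂ) * Complex.I * Complex.sin z

/-- The half-strip `S_{α,β} = {z : Re z > α, |Im z| < β}`. -/
def S (α β : ℝ) : Set ℂ := {z : ℂ | α < z.re ∧ |z.im| < β}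

/-- The tract `T = {z ∈ S_{-1,π/3} : h(z) ∈ S_{0,π}}`. -/
noncomputable def T : Set ℂ := {z ∈ S (-1) (π / 3) | h z ∈ S 0 π}

theorem h_im (x y : ℝ) :
    (h ⟨x, y⟩).im = 5 * π * y + 2 * π * (Real.sin x * Real.cosh y) := by
  have hz : (⟨x, y⟩ : ℂ) = x + y * I := Complex.mk_eq_add_mul_I x y
  rw [h, hz, Complex.sin_add_mul_I, ← Complex.ofReal_sin, ← Complex.ofReal_cos,
    ← Complex.ofReal_sinh, ← Complex.ofReal_cosh]
  simp [-Complex.ofReal_sin, -Complex.ofReal_cos, -Complex.ofReal_sinh, -Complex.ofReal_cosh]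

/-- No horizontal line meets `T` above both a maximum and a minimum of `sin`. -/
theorem not_mem_T_of_sin_eq {x₁ x₂ y : ℝ} (h₁ : Real.sin x₁ = 1) (h₂ : Real.sin x₂ = -1)
    (hx₁ : (⟨x₁, y⟩ : ℂ) ∈ T) : (⟨x₂, y⟩ : ℂ) ∉ T := by
  intro hx₂
  have him₁ := (abs_lt.mp hx₁.2.2).2
  have him₂ := (abs_lt.mp hx₂.2.2).1
  rw [h_im, h₁] at him₁
  rw [h_im, h₂] at him₂
  nlinarith [Real.pi_pos, Real.one_le_cosh y]

/-- `T` contains no ray: for every `a ∈ ℂ` and `b ≠ 0`, the ray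
`{a + t·b : t ∈ [0,∞)}` is not contained in `T`. -/
theorem stmt_11 (a b : ℂ) (hb : b ≠ 0) :
    ¬ ((fun t : ℝ => a + (t : ℂ) * b) '' Set.Ici 0 ⊆ T) := by
  intro hsub
  have hmem (t : ℝ) (ht : 0 ≤ t) : (⟨a.re + t * b.re, a.im + t * b.im⟩ : ℂ) ∈ T := by
    convert hsub (Set.mem_image_of_mem _ (Set.mem_Ici.mpr ht)) using 1
    apply Complex.ext <;> simp
  have him : b.im = 0 := by
    by_contra hne
    have hpos : 0 < |b.im| := abs_pos.mpr hne
    have ht : 0 ≤ 2 * π / |b.im| := by positivity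
    have h₀ : |a.im + 0 * b.im| < π / 3 := (hmem 0 le_rfl).1.2
    have h₁ : |a.im + 2 * π / |b.im| * b.im| < π / 3 := (hmem _ ht).1.2
    have hdiff : |2 * π / |b.im| * b.im| = 2 * π := by
      rw [abs_mul, abs_of_nonneg ht, div_mul_cancel₀ _ hpos.ne']
    have htri := abs_sub (a.im + 2 * π / |b.im| * b.im) (a.im + 0 * b.im)
    rw [show a.im + 2 * π / |b.im| * b.im - (a.im + 0 * b.im) = 2 * π / |b.im| * b.im by ring,
      hdiff] at htri
    linarith [Real.pi_pos]
  have hre : 0 < b.re := by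
    have hne : b.re ≠ 0 := fun h0 => hb (Complex.ext h0 him)
    by_contra! hle
    have hneg : 0 < -b.re := neg_pos.mpr (lt_of_le_of_ne hle hne)
    have h₀ : -1 < a.re + 0 * b.re := (hmem 0 le_rfl).1.1
    have ht : 0 ≤ (a.re + 1) / -b.re := div_nonneg (by linarith) hneg.le
    have h₁ : -1 < a.re + (a.re + 1) / -b.re * b.re := (hmem _ ht).1.1
    have hcancel : (a.re + 1) / -b.re * b.re = -(a.re + 1) := by
      field_simp
    linarith
  have hline (x : ℝ) (hx : a.re ≤ x) : (⟨x, a.im⟩ : ℂ) ∈ T := by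
    have ht := hmem ((x - a.re) / b.re) (div_nonneg (sub_nonneg.mpr hx) hre.le)
    rwa [div_mul_cancel₀ _ hre.ne', him, mul_zero, add_zero, add_sub_cancel] at ht
  obtain ⟨n, hn⟩ := exists_nat_ge ((a.re + π / 2) / (2 * π))
  rw [div_le_iff₀ Real.two_pi_pos] at hn
  refine not_mem_T_of_sin_eq (x₁ := π / 2 + n * (2 * π)) (x₂ := -(π / 2) + n * (2 * π)) ?_ ?_
    (hline _ ?_) (hline _ ?_)
  · rw [Real.sin_add_nat_mul_two_pi, Real.sin_pi_div_two]
  · rw [Real.sin_add_nat_mul_two_pi, Real.sin_neg, Real.sin_pi_div_two]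
  · linarith [Real.pi_pos]
  · linarith
end

section
/- Let R > 1 and let φ : [R,∞) → ℝ be differentiable with |φ(t)| ≤ π/3 for all t ≥ R, and suppose that 5·φ(t) + 2·sin(log t)·cosh(φ(t)) = 1 for all t ≥ R (or, alternatively, that this expression equals −1 for all t ≥ R). Then |φ'(t)| ≤ 2/t for all t ≥ R. -/
open Real

theorem sinh_pi_div_three_lt : Real.sinh (π / 3) < 5 / 4 := by
  have hpi : π / 3 ≤ 1 + 0.0472 := by linarith [Real.pi_lt_d4]
  have h1 : Real.exp (0.0472 : ℝ) ≤ 1.04834 := by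
    refine (Real.exp_bound' (by norm_num) (by norm_num) (n := 3) (by norm_num)).trans ?_
    norm_num [Finset.sum_range_succ, Nat.factorial]
  have hy : Real.exp (π / 3) ≤ 2.8507 := by
    calc Real.exp (π / 3) ≤ Real.exp (1 + 0.0472) := Real.exp_le_exp.2 hpi
      _ = Real.exp 1 * Real.exp 0.0472 := Real.exp_add _ _
      _ ≤ 2.7182818286 * 1.04834 :=
        mul_le_mul Real.exp_one_lt_d9.le h1 (Real.exp_pos _).le (by norm_num)
      _ ≤ 2.8507 := by norm_num
  have hinv : (2.8507 : ℝ)⁻¹ ≤ (Real.exp (π / 3))⁻¹ := inv_anti₀ (Real.exp_pos _) hy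
  rw [Real.sinh_eq, Real.exp_neg]
  norm_num at hinv hy ⊢
  linarith

theorem abs_sinh_lt_of_abs_le_pi_div_three {x : ℝ} (hx : |x| ≤ π / 3) :
    |Real.sinh x| < 5 / 4 := by
  rw [Real.abs_sinh]
  exact (Real.sinh_le_sinh.2 hx).trans_lt sinh_pi_div_three_lt

theorem cosh_lt_of_abs_le_pi_div_three {x : ℝ} (hx : |x| ≤ π / 3) :
    Real.cosh x < 5 / 2 := by
  have hs := abs_lt.1 (abs_sinh_lt_of_abs_le_pi_div_three hx)
  nlinarith [Real.cosh_sq x, Real.cosh_pos x]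

/-- The derivative bound, with an arbitrary constant on the right-hand side of the identity. -/
theorem abs_deriv_le_of_identity {R c : ℝ} (hR : 0 < R) {φ φ' : ℝ → ℝ}
    (hbd : ∀ t, R ≤ t → |φ t| ≤ π / 3)
    (hderiv : ∀ t, R ≤ t → HasDerivWithinAt φ (φ' t) (Set.Ici R) t)
    (heq : ∀ t, R ≤ t → 5 * φ t + 2 * Real.sin (Real.log t) * Real.cosh (φ t) = c)
    {t : ℝ} (ht : R ≤ t) : |φ' t| ≤ 2 / t := by
  have ht0 : 0 < t := hR.trans_le ht
  have hφ := hderiv t ht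
  have hlog := (Real.hasDerivAt_log ht0.ne').hasDerivWithinAt (s := Set.Ici R)
  have hF := (hφ.const_mul 5).add ((hlog.sin.const_mul 2).mul hφ.cosh)
  have hconst : HasDerivWithinAt (fun _ : ℝ => c) 0 (Set.Ici R) t :=
    hasDerivWithinAt_const t _ c
  have hzero := (uniqueDiffOn_Ici R t ht).eq_deriv _ hF
    (hconst.congr (fun s hs => heq s hs) (heq t ht))
  set D := 5 + 2 * Real.sin (Real.log t) * Real.sinh (φ t) with hD
  have hmul : φ' t * D = -(2 * Real.cos (Real.log t) * Real.cosh (φ t) / t) := by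
    rw [hD, div_eq_mul_inv]
    linear_combination hzero
  have hsin : |Real.sin (Real.log t) * Real.sinh (φ t)| ≤ 1 * (5 / 4) := by
    rw [abs_mul]
    exact mul_le_mul (Real.abs_sin_le_one _)
      (abs_sinh_lt_of_abs_le_pi_div_three (hbd t ht)).le (abs_nonneg _) zero_le_one
  have hDge : 5 / 2 ≤ D := by linarith [(abs_le.1 hsin).1]
  have hcos : |Real.cos (Real.log t)| * Real.cosh (φ t) ≤ 1 * (5 / 2) :=
    mul_le_mul (Real.abs_cos_le_one _)
      (cosh_lt_of_abs_le_pi_div_three (hbd t ht)).le (Real.cosh_pos _).le zero_le_one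
  have habs : |φ' t| * D = 2 * (|Real.cos (Real.log t)| * Real.cosh (φ t)) / t := by
    have h := congrArg abs hmul
    rwa [abs_mul, abs_of_pos (by linarith : 0 < D), abs_neg, abs_div, abs_mul, abs_mul,
      abs_two, abs_of_pos ht0, abs_of_pos (Real.cosh_pos _), mul_assoc] at h
  rw [le_div_iff₀ ht0]
  rw [eq_div_iff ht0.ne'] at habs
  nlinarith [mul_le_mul_of_nonneg_left hDge (mul_nonneg (abs_nonneg (φ' t)) ht0.le)]

/-- If `φ : [R,∞) → ℝ` is differentiable with `|φ(t)| ≤ π/3` and satisfies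
`5φ(t) + 2 sin(log t) cosh(φ(t)) = 1` (or `= -1`) for all `t ≥ R > 1`, then
`|φ'(t)| ≤ 2/t` for all `t ≥ R`. -/
theorem stmt_13 (R : ℝ) (hR : 1 < R) (φ φ' : ℝ → ℝ)
    (hbd : ∀ t, R ≤ t → |φ t| ≤ π / 3)
    (hderiv : ∀ t, R ≤ t → HasDerivWithinAt φ (φ' t) (Set.Ici R) t)
    (heq : (∀ t, R ≤ t → 5 * φ t + 2 * Real.sin (Real.log t) * Real.cosh (φ t) = 1) ∨
           (∀ t, R ≤ t → 5 * φ t + 2 * Real.sin (Real.log t) * Real.cosh (φ t) = -1)) :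
    ∀ t, R ≤ t → |φ' t| ≤ 2 / t := by
  intro t ht
  have hR0 : 0 < R := zero_lt_one.trans hR
  rcases heq with h | h
  · exact abs_deriv_le_of_identity hR0 hbd hderiv h ht
  · exact abs_deriv_le_of_identity hR0 hbd hderiv h ht
end
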